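/- arXiv:quant-ph/0702184 — 2 statements merged into one kernel-verified Lean document; each statement's English description precedes it below -/
import Mathlib

section
/- Let C₂ ⊆ C₁ be F₂-linear subspaces of F₂ⁿ with dim C₁ = k₁ and dim C₂ = k₂. Then the ℂ-linear span of the set of CSS basis vectors {ψ_v : v ∈ C₁} has complex dimension 2^(k₁ - k₂). (Thus the CSS code built from C₁ ⊃ C₂ is an [n, k₁ - k₂] quantum code.) -/
open Classical in
/-- The (unnormalized) CSS basis vector `ψ_v = Σ_{w ∈ C₂} e_{v+w}`:
the indicator function of the coset `v + C₂`. -/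
noncomputable def cssVec (n : ℕ) (C₂ : Submodule (ZMod 2) (Fin n → ZMod 2))
    (v : Fin n → ZMod 2) : (Fin n → ZMod 2) → ℂ :=
  fun x => if x - v ∈ C₂ then 1 else 0

theorem cssVec_apply_of_notMem {n : ℕ} {C₂ : Submodule (ZMod 2) (Fin n → ZMod 2)}
    {v x : Fin n → ZMod 2} (h : x - v ∉ C₂) : cssVec n C₂ v x = 0 := by
  simp [cssVec, h]

/-- The CSS basis vector `ψ_v` depends only on the coset `v + C₂`. -/
theorem cssVec_eq_of_sub_mem {n : ℕ} {C₂ : Submodule (ZMod 2) (Fin n → ZMod 2)}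
    {v w : Fin n → ZMod 2} (h : v - w ∈ C₂) : cssVec n C₂ v = cssVec n C₂ w := by
  funext x
  have hx : x - v ∈ C₂ ↔ x - w ∈ C₂ := by
    rw [← sub_add_sub_cancel x v w, C₂.add_mem_iff_left h]
  by_cases hw : x - w ∈ C₂ <;> simp [cssVec, hx, hw]

/-- CSS basis vectors of pairwise distinct cosets of `C₂` are linearly independent. -/
theorem linearIndependent_cssVec {n : ℕ} {C₂ : Submodule (ZMod 2) (Fin n → ZMod 2)}
    {ι : Type*} [Fintype ι] (r : ι → Fin n → ZMod 2)
    (hr : ∀ i j, r i - r j ∈ C₂ → i = j) :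
    LinearIndependent ℂ fun i => cssVec n C₂ (r i) := by
  rw [Fintype.linearIndependent_iff]
  intro g hg j
  have hj := congrFun hg (r j)
  rw [Finset.sum_apply, Finset.sum_eq_single j] at hj
  · simpa [cssVec] using hj
  · intro i _ hij
    have hne : r j - r i ∉ C₂ := fun h => hij (hr j i h).symm
    simp [cssVec_apply_of_notMem hne]
  · simp

/-- If `C₂ ⊆ C₁` with `dim C₁ = k₁` and `dim C₂ = k₂`, then the ℂ-span of the
CSS basis vectors `{ψ_v : v ∈ C₁}` has complex dimension `2^(k₁ - k₂)`:
the CSS code built from `C₁ ⊃ C₂` is an `[n, k₁ - k₂]` quantum code. -/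
theorem cssCode_dim (n k₁ k₂ : ℕ)
    (C₁ C₂ : Submodule (ZMod 2) (Fin n → ZMod 2)) (hsub : C₂ ≤ C₁)
    (hk₁ : Module.finrank (ZMod 2) C₁ = k₁)
    (hk₂ : Module.finrank (ZMod 2) C₂ = k₂) :
    Module.finrank ℂ (Submodule.span ℂ (cssVec n C₂ '' (C₁ : Set (Fin n → ZMod 2)))) =
      2 ^ (k₁ - k₂) := by
  let D : Submodule (ZMod 2) C₁ := C₂.comap C₁.subtype
  let r : C₁ ⧸ D → Fin n → ZMod 2 := fun q => (q.out : C₁)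
  have : Fintype (C₁ ⧸ D) :=
    @Fintype.ofFinite _ (Finite.of_surjective _ D.mkQ_surjective)
  have hmk : ∀ q : C₁ ⧸ D, Submodule.Quotient.mk q.out = q := fun q => Quotient.out_eq' q
  have hr : ∀ p q, r p - r q ∈ C₂ → p = q := by
    intro p q h
    rw [← hmk p, ← hmk q, Submodule.Quotient.eq]
    exact h
  have himage : cssVec n C₂ '' (C₁ : Set (Fin n → ZMod 2)) =
      Set.range fun q => cssVec n C₂ (r q) := by
    ext f
    constructor
    · rintro ⟨v, hv, rfl⟩
      refine ⟨Submodule.Quotient.mk ⟨v, hv⟩, cssVec_eq_of_sub_mem ?_⟩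
      exact (Submodule.Quotient.eq D).mp (hmk (Submodule.Quotient.mk ⟨v, hv⟩))
    · rintro ⟨q, rfl⟩
      exact ⟨r q, q.out.2, rfl⟩
  have hD : Module.finrank (ZMod 2) D = k₂ := by
    rw [← hk₂]
    exact (Submodule.comapSubtypeEquivOfLe hsub).finrank_eq
  have hquot : Module.finrank (ZMod 2) (C₁ ⧸ D) = k₁ - k₂ := by
    rw [Submodule.finrank_quotient, hk₁, hD]
  rw [himage, finrank_span_eq_card (linearIndependent_cssVec r hr),
    Module.card_eq_pow_finrank (K := ZMod 2), hquot, ZMod.card]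
end

section
/- Let H be an M×N matrix over the binary field F₂ with H · Hᵀ = 0. If two distinct rows i ≠ j of H have intersecting supports (some column k with H i k = 1 and H j k = 1), then there exist two distinct columns k₁ ≠ k₂ with H i k₁ = H j k₁ = H i k₂ = H j k₂ = 1; that is, the Tanner graph of H contains a cycle of length four. -/
open Matrix

/-- If `H * Hᵀ = 0` and two distinct rows of `H` have intersecting supports,
then there are two distinct columns on which both rows equal `1`: the Tanner
graph of `H` contains a cycle of length four. -/
theorem four_cycle_of_dual_containing (M N : ℕ)
    (H : Matrix (Fin M) (Fin N) (ZMod 2)) (hH : H * Hᵀ = 0)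
    (i j : Fin M) (hij : i ≠ j)
    (hmeet : ∃ k : Fin N, H i k = 1 ∧ H j k = 1) :
    ∃ k₁ k₂ : Fin N, k₁ ≠ k₂ ∧
      H i k₁ = 1 ∧ H j k₁ = 1 ∧ H i k₂ = 1 ∧ H j k₂ = 1 := by
  obtain ⟨k, hik, hjk⟩ := hmeet
  by_contra! hne
  have hsum : ∑ l, H i l * H j l = 0 := by
    simpa [Matrix.mul_apply] using congrFun₂ hH i j
  rw [Finset.sum_eq_single k, hik, hjk] at hsum
  · exact absurd hsum (by decide)
  · intro l _ hl
    have hzero_or_one : ∀ a b : ZMod 2, a * b = 0 ∨ a = 1 ∧ b = 1 := by decide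
    exact (hzero_or_one _ _).resolve_right
      fun h => hne k l hl.symm hik hjk h.1 h.2
  · simp
end
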